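/- arXiv:2208.07803 — 5 statements merged into one kernel-verified Lean document; each statement's English description precedes it below -/
import Mathlib

section
/- In U(ŝl_{n+1}) the commutator identity e_r f_r − f_r e_r = (k_r − k_r⁻¹)/(v − v⁻¹) holds, i.e. e_r f_r − f_r e_r = (K̆_r K̆_{r+1} − K̆_r⁻¹ K̆_{r+1}⁻¹)/(v − v⁻¹). -/
noncomputable section

/-- The field ℚ(v) of rational functions over ℚ. -/
abbrev Qv : Type := RatFunc ℚ

/-- The indeterminate v. -/
def vv : Qv := RatFunc.X

/-- The quantum integer [a] = (v^a - v^{-a})/(v - v⁻¹). -/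
def qint (a : ℕ) : Qv := (vv ^ (a : ℤ) - vv ^ (-(a : ℤ))) / (vv - vv⁻¹)

/-- The quantum factorial [a]! = [a][a-1]⋯[1]. -/
def qfact : ℕ → Qv
  | 0 => 1
  | n + 1 => qint (n + 1) * qfact n

/-- Divided power x^{(p)} = x^p / [p]!. -/
def dp {A : Type} [Ring A] [Algebra Qv A] (x : A) (p : ℕ) : A :=
  (qfact p)⁻¹ • x ^ p

/-- The affine type A Cartan matrix entries c_{ij} = 2δ_{i,j} - δ_{i,j+1} - δ_{i,j-1}. -/
def cartan {m : ℕ} (i j : ZMod m) : ℤ :=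
  (if i = j then 2 else 0) - (if i = j + 1 then 1 else 0) - (if i = j - 1 then 1 else 0)

/-- Generators of the quantum affine algebra U(ŝl_m). -/
inductive Gen (m : ℕ) : Type
  | E : ZMod m → Gen m
  | F : ZMod m → Gen m
  | K : ZMod m → Gen m
  | Kinv : ZMod m → Gen m

abbrev FA (m : ℕ) := FreeAlgebra Qv (Gen m)

def fE {m : ℕ} (i : ZMod m) : FA m := FreeAlgebra.ι Qv (Gen.E i)
def fF {m : ℕ} (i : ZMod m) : FA m := FreeAlgebra.ι Qv (Gen.F i)
def fK {m : ℕ} (i : ZMod m) : FA m := FreeAlgebra.ι Qv (Gen.K i)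
def fKinv {m : ℕ} (i : ZMod m) : FA m := FreeAlgebra.ι Qv (Gen.Kinv i)

/-- The defining relations of the quantum affine algebra U(ŝl_m). -/
inductive URel (m : ℕ) : FA m → FA m → Prop
  | KK : ∀ i j, URel m (fK i * fK j) (fK j * fK i)
  | KKinv : ∀ i, URel m (fK i * fKinv i) 1
  | KinvK : ∀ i, URel m (fKinv i * fK i) 1
  | KE : ∀ i j, URel m (fK i * fE j) (vv ^ cartan i j • (fE j * fK i))
  | KF : ∀ i j, URel m (fK i * fF j) (vv ^ (-cartan i j) • (fF j * fK i))
  | EF : ∀ i j, URel m (fE i * fF j - fF j * fE i)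
      (if i = j then (vv - vv⁻¹)⁻¹ • (fK i - fKinv i) else 0)
  | serreE : ∀ i j, i ≠ j →
      URel m (∑ p ∈ Finset.range ((1 - cartan i j).toNat + 1),
        ((-1 : Qv) ^ p) • (dp (fE i) p * fE j * dp (fE i) ((1 - cartan i j).toNat - p))) 0
  | serreF : ∀ i j, i ≠ j →
      URel m (∑ p ∈ Finset.range ((1 - cartan i j).toNat + 1),
        ((-1 : Qv) ^ p) • (dp (fF i) p * fF j * dp (fF i) ((1 - cartan i j).toNat - p))) 0

/-- The quantum affine algebra U(ŝl_m), presented by generators and relations. -/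
abbrev U (m : ℕ) := RingQuot (URel m)

def UE {m : ℕ} (i : ZMod m) : U m := RingQuot.mkAlgHom Qv (URel m) (fE i)
def UF {m : ℕ} (i : ZMod m) : U m := RingQuot.mkAlgHom Qv (URel m) (fF i)
def UK {m : ℕ} (i : ZMod m) : U m := RingQuot.mkAlgHom Qv (URel m) (fK i)
def UKinv {m : ℕ} (i : ZMod m) : U m := RingQuot.mkAlgHom Qv (URel m) (fKinv i)

/-- The element e_r = Ĕ_r Ĕ_{r+1} − v^ε Ĕ_{r+1} Ĕ_r in U(ŝl_{n+1}). -/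
def er (n r : ℕ) (ε : ℤ) : U (n + 1) :=
  UE (r : ZMod (n + 1)) * UE ((r : ZMod (n + 1)) + 1) -
    vv ^ ε • (UE ((r : ZMod (n + 1)) + 1) * UE (r : ZMod (n + 1)))

/-- The element f_r = F̆_{r+1} F̆_r − v^{−ε} F̆_r F̆_{r+1} in U(ŝl_{n+1}). -/
def fr (n r : ℕ) (ε : ℤ) : U (n + 1) :=
  UF ((r : ZMod (n + 1)) + 1) * UF (r : ZMod (n + 1)) -
    vv ^ (-ε) • (UF (r : ZMod (n + 1)) * UF ((r : ZMod (n + 1)) + 1))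

/-- The element k_r = K̆_r K̆_{r+1} in U(ŝl_{n+1}). -/
def kr (n r : ℕ) : U (n + 1) :=
  UK (r : ZMod (n + 1)) * UK ((r : ZMod (n + 1)) + 1)

/-- The image e_i ∈ U(ŝl_{n+1}) of the generator E_i, i ∈ ℤ/nℤ. -/
def eElt (n r : ℕ) (ε : ℤ) (i : ZMod n) : U (n + 1) :=
  if i.val < r then UE ((i.val : ZMod (n + 1)))
  else if i.val = r then er n r ε
  else UE ((i.val + 1 : ℕ) : ZMod (n + 1))

def fElt (n r : ℕ) (ε : ℤ) (i : ZMod n) : U (n + 1) :=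
  if i.val < r then UF ((i.val : ZMod (n + 1)))
  else if i.val = r then fr n r ε
  else UF ((i.val + 1 : ℕ) : ZMod (n + 1))

def kElt (n r : ℕ) (i : ZMod n) : U (n + 1) :=
  if i.val < r then UK ((i.val : ZMod (n + 1)))
  else if i.val = r then kr n r
  else UK ((i.val + 1 : ℕ) : ZMod (n + 1))

def kinvElt (n r : ℕ) (i : ZMod n) : U (n + 1) :=
  if i.val < r then UKinv ((i.val : ZMod (n + 1)))
  else if i.val = r then UKinv (r : ZMod (n + 1)) * UKinv ((r : ZMod (n + 1)) + 1)
  else UKinv ((i.val + 1 : ℕ) : ZMod (n + 1))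


/-- If `K * x = c • (x * K)` and `L` is a two-sided inverse of `K`, then `L` commutes with `x` up to
the inverse scalar. -/
theorem inverse_mul_eq_smul {k A : Type*} [Field k] [Ring A] [Algebra k A] {c : k} (hc : c ≠ 0)
    {K L x : A} (hKL : K * L = 1) (hLK : L * K = 1) (h : K * x = c • (x * K)) :
    L * x = c⁻¹ • (x * L) := by
  have h₁ : x * L = c • (L * x) := by
    calc x * L = L * (K * x) * L := by rw [← mul_assoc, hLK, one_mul]
      _ = c • (L * x) := by
        rw [h, mul_smul_comm, smul_mul_assoc, mul_assoc, mul_assoc, hKL, mul_one]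
  rw [h₁, smul_smul, inv_mul_cancel₀ hc, one_smul]

/-- The commutator of two elements of the form `x * y - q • (y * x)` and `G * F - q⁻¹ • (F * G)`,
where `(x, F)` and `(y, G)` generate two adjacent copies of quantum `sl₂`. -/
theorem quantum_root_vector_commutator {k A : Type*} [Field k] [Ring A] [Algebra k A]
    {q : k} (hq : q ≠ 0) (hq' : q - q⁻¹ ≠ 0) {x y F G Ka Kb La Lb : A}
    (hxF : x * F = F * x + (q - q⁻¹)⁻¹ • (Ka - La))
    (hyG : y * G = G * y + (q - q⁻¹)⁻¹ • (Kb - Lb))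
    (hxG : x * G = G * x) (hyF : y * F = F * y)
    (hKbx : Kb * x = q⁻¹ • (x * Kb)) (hLbx : Lb * x = q • (x * Lb))
    (hKay : Ka * y = q⁻¹ • (y * Ka)) (hLay : La * y = q • (y * La))
    (hKaG : Ka * G = q • (G * Ka)) (hLbF : Lb * F = q⁻¹ • (F * Lb))
    (hKK : Kb * Ka = Ka * Kb) (hLK : Lb * Ka = Ka * Lb) :
    (x * y - q • (y * x)) * (G * F - q⁻¹ • (F * G)) -
      (G * F - q⁻¹ • (F * G)) * (x * y - q • (y * x)) =
        (q - q⁻¹)⁻¹ • (Ka * Kb - La * Lb) := by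
  have hqi : q * q⁻¹ = 1 := mul_inv_cancel₀ hq
  have hd : (q - q⁻¹)⁻¹ * (q - q⁻¹) = 1 := inv_mul_cancel₀ hq'
  obtain ⟨e, he⟩ : ∃ e, e = x * y - q • (y * x) := ⟨_, rfl⟩
  have heG : e * G = G * e + q • (x * Lb) := by
    have hxyG : x * y * G = G * (x * y) + (q - q⁻¹)⁻¹ • (x * Kb - x * Lb) := by
      rw [mul_assoc, hyG, mul_add, ← mul_assoc, hxG, mul_assoc, mul_smul_comm, mul_sub]
    have hyxG : y * x * G =
        G * (y * x) + (q - q⁻¹)⁻¹ • (q⁻¹ • (x * Kb) - q • (x * Lb)) := by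
      rw [mul_assoc, hxG, ← mul_assoc, hyG, add_mul, mul_assoc, smul_mul_assoc, sub_mul, hKbx, hLbx]
    rw [he, sub_mul, smul_mul_assoc, hxyG, hyxG, mul_sub, mul_smul_comm]
    match_scalars
    · rfl
    · linear_combination -(q - q⁻¹)⁻¹ * hqi
    · linear_combination q * hd + (q - q⁻¹)⁻¹ * hqi
    · rfl
  have heF : e * F = F * e - y * Ka := by
    have hxyF : x * y * F =
        F * (x * y) + (q - q⁻¹)⁻¹ • (q⁻¹ • (y * Ka) - q • (y * La)) := by
      rw [mul_assoc, hyF, ← mul_assoc, hxF, add_mul, mul_assoc, smul_mul_assoc, sub_mul, hKay, hLay]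
    have hyxF : y * x * F = F * (y * x) + (q - q⁻¹)⁻¹ • (y * Ka - y * La) := by
      rw [mul_assoc, hxF, mul_add, ← mul_assoc, hyF, mul_assoc, mul_smul_comm, mul_sub]
    rw [he, sub_mul, smul_mul_assoc, hxyF, hyxF, mul_sub, mul_smul_comm]
    match_scalars
    · rfl
    · linear_combination -hd
    · ring
    · rfl
  rw [← he]
  have hGF : e * (G * F) = G * F * e - G * y * Ka + x * F * Lb := by
    rw [← mul_assoc, heG, add_mul, mul_assoc, heF, smul_mul_assoc, mul_assoc x, hLbF,
      mul_smul_comm, smul_smul, mul_inv_cancel₀ hq, one_smul, mul_sub]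
    noncomm_ring
  have hFG : e * (F * G) = F * G * e + q • (F * x * Lb) - q • (y * G * Ka) := by
    rw [← mul_assoc, heF, sub_mul, mul_assoc, heG, mul_assoc y, hKaG, mul_add, mul_smul_comm,
      mul_smul_comm]
    simp only [mul_assoc]
  rw [mul_sub, sub_mul, mul_smul_comm, smul_mul_assoc, hGF, hFG, hxF, hyG, add_mul, add_mul,
    smul_mul_assoc, smul_mul_assoc, sub_mul, sub_mul, hKK, hLK]
  match_scalars <;> field_simp <;> ring

theorem inv_sub_inv_smul_sub {k M : Type*} [Field k] [AddCommGroup M] [Module k M] (q : k)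
    (x y : M) : (q - q⁻¹)⁻¹ • (x - y) = (q⁻¹ - (q⁻¹)⁻¹)⁻¹ • (y - x) := by
  rw [inv_inv, ← neg_sub q, inv_neg, neg_smul, ← smul_neg, neg_sub]

theorem vv_ne_zero : vv ≠ 0 := RatFunc.X_ne_zero

theorem vv_sub_inv_ne_zero : vv - vv⁻¹ ≠ 0 := by
  intro h
  have h₁ : vv * vv = 1 := by
    rw [sub_eq_zero] at h
    nth_rewrite 2 [h]
    exact mul_inv_cancel₀ vv_ne_zero
  have h₂ : (Polynomial.X * Polynomial.X : Polynomial ℚ) = 1 := by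
    apply RatFunc.algebraMap_injective ℚ
    simpa [vv] using h₁
  have h₃ := congrArg (Polynomial.eval 2) h₂
  norm_num at h₃

section Relations

variable {m : ℕ}

theorem UK_mul_UKinv (i : ZMod m) : UK i * UKinv i = 1 := by
  simpa [UK, UKinv] using RingQuot.mkAlgHom_rel Qv (URel.KKinv i)

theorem UKinv_mul_UK (i : ZMod m) : UKinv i * UK i = 1 := by
  simpa [UK, UKinv] using RingQuot.mkAlgHom_rel Qv (URel.KinvK i)

theorem UK_mul_UK (i j : ZMod m) : UK i * UK j = UK j * UK i := by
  simpa [UK] using RingQuot.mkAlgHom_rel Qv (URel.KK i j)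

theorem UK_mul_UE (i j : ZMod m) : UK i * UE j = vv ^ cartan i j • (UE j * UK i) := by
  simpa only [UK, UE, map_mul, map_smul] using RingQuot.mkAlgHom_rel Qv (URel.KE i j)

theorem UK_mul_UF (i j : ZMod m) : UK i * UF j = vv ^ (-cartan i j) • (UF j * UK i) := by
  simpa only [UK, UF, map_mul, map_smul] using RingQuot.mkAlgHom_rel Qv (URel.KF i j)

theorem UE_mul_UF_self (i : ZMod m) :
    UE i * UF i = UF i * UE i + (vv - vv⁻¹)⁻¹ • (UK i - UKinv i) := by
  have h := RingQuot.mkAlgHom_rel Qv (URel.EF i i)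
  rw [if_pos rfl, map_sub, map_mul, map_mul, map_smul, map_sub] at h
  exact sub_eq_iff_eq_add'.mp h

theorem UE_mul_UF_of_ne {i j : ZMod m} (hij : i ≠ j) : UE i * UF j = UF j * UE i := by
  have h := RingQuot.mkAlgHom_rel Qv (URel.EF i j)
  rw [if_neg hij, map_sub, map_mul, map_mul, map_zero] at h
  exact sub_eq_zero.mp h

theorem UKinv_mul_UK_comm (i j : ZMod m) : UKinv i * UK j = UK j * UKinv i := by
  simpa using inverse_mul_eq_smul (one_ne_zero (α := Qv)) (UK_mul_UKinv i) (UKinv_mul_UK i)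
    (by rw [one_smul, UK_mul_UK i j])

theorem UKinv_mul_UKinv (i j : ZMod m) : UKinv i * UKinv j = UKinv j * UKinv i := by
  simpa using inverse_mul_eq_smul (one_ne_zero (α := Qv)) (UK_mul_UKinv i) (UKinv_mul_UK i)
    (by rw [one_smul, UKinv_mul_UK_comm j i])

variable {i j : ZMod m}

theorem UK_mul_UE_of_adjacent (h : cartan i j = -1) : UK i * UE j = vv⁻¹ • (UE j * UK i) := by
  simpa [h] using UK_mul_UE i j

theorem UK_mul_UF_of_adjacent (h : cartan i j = -1) : UK i * UF j = vv • (UF j * UK i) := by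
  simpa [h] using UK_mul_UF i j

theorem UKinv_mul_UE_of_adjacent (h : cartan i j = -1) :
    UKinv i * UE j = vv • (UE j * UKinv i) := by
  simpa using inverse_mul_eq_smul (inv_ne_zero vv_ne_zero) (UK_mul_UKinv i) (UKinv_mul_UK i)
    (UK_mul_UE_of_adjacent h)

theorem UKinv_mul_UF_of_adjacent (h : cartan i j = -1) :
    UKinv i * UF j = vv⁻¹ • (UF j * UKinv i) :=
  inverse_mul_eq_smul vv_ne_zero (UK_mul_UKinv i) (UKinv_mul_UK i) (UK_mul_UF_of_adjacent h)

end Relations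

theorem add_two_ne_self {n : ℕ} (hn : 2 ≤ n) (a : ZMod (n + 1)) : a + 1 + 1 ≠ a := by
  intro h
  have h₂ : ((2 : ℕ) : ZMod (n + 1)) = 0 := by
    push_cast
    linear_combination h
  have := Nat.le_of_dvd two_pos ((ZMod.natCast_eq_zero_iff _ _).mp h₂)
  omega

theorem add_one_ne_self {n : ℕ} (hn : 2 ≤ n) (a : ZMod (n + 1)) : a + 1 ≠ a := fun h =>
  add_two_ne_self hn a (by rw [h, h])

theorem cartan_add_one_right {n : ℕ} (hn : 2 ≤ n) (a : ZMod (n + 1)) : cartan a (a + 1) = -1 := by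
  simp [cartan, (add_one_ne_self hn a).symm, (add_two_ne_self hn a).symm]

theorem cartan_add_one_left {n : ℕ} (hn : 2 ≤ n) (a : ZMod (n + 1)) : cartan (a + 1) a = -1 := by
  have h : a + 1 ≠ a - 1 := fun h => add_two_ne_self hn a (by rw [h, sub_add_cancel])
  simp [cartan, add_one_ne_self hn a, h]

/-- e_r f_r − f_r e_r = (k_r − k_r⁻¹)/(v − v⁻¹) in U(ŝl_{n+1}). -/
theorem er_fr_commutator
    (n r : ℕ) (hn : 2 ≤ n) (hr : r ≤ n - 1) (ε : ℤ) (hε : ε = 1 ∨ ε = -1) :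
    er n r ε * fr n r ε - fr n r ε * er n r ε =
      (vv - vv⁻¹)⁻¹ •
        (UK (r : ZMod (n + 1)) * UK ((r : ZMod (n + 1)) + 1) -
          UKinv (r : ZMod (n + 1)) * UKinv ((r : ZMod (n + 1)) + 1)) := by
  unfold er fr
  generalize (r : ZMod (n + 1)) = a
  have hright := cartan_add_one_right hn a
  have hleft := cartan_add_one_left hn a
  have hne := add_one_ne_self hn a
  rcases hε with rfl | rfl
  · rw [zpow_neg, zpow_one]
    exact quantum_root_vector_commutator vv_ne_zero vv_sub_inv_ne_zero
      (UE_mul_UF_self a) (UE_mul_UF_self (a + 1)) (UE_mul_UF_of_ne hne.symm) (UE_mul_UF_of_ne hne)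
      (UK_mul_UE_of_adjacent hleft) (UKinv_mul_UE_of_adjacent hleft)
      (UK_mul_UE_of_adjacent hright) (UKinv_mul_UE_of_adjacent hright)
      (UK_mul_UF_of_adjacent hright) (UKinv_mul_UF_of_adjacent hleft)
      (UK_mul_UK _ _) (UKinv_mul_UK_comm _ _)
  · rw [zpow_neg, zpow_neg, zpow_neg, zpow_one, inv_sub_inv_smul_sub]
    refine quantum_root_vector_commutator (inv_ne_zero vv_ne_zero) ?_
      ((UE_mul_UF_self a).trans ?_) ((UE_mul_UF_self (a + 1)).trans ?_)
      (UE_mul_UF_of_ne hne.symm) (UE_mul_UF_of_ne hne)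
      ?_ (UK_mul_UE_of_adjacent hleft) ?_ (UK_mul_UE_of_adjacent hright)
      (UKinv_mul_UF_of_adjacent hright) ?_ (UKinv_mul_UKinv _ _) (UKinv_mul_UK_comm _ _).symm
    · rw [inv_inv, ← neg_sub, neg_ne_zero]
      exact vv_sub_inv_ne_zero
    · rw [inv_sub_inv_smul_sub]
    · rw [inv_sub_inv_smul_sub]
    · rw [inv_inv]
      exact UKinv_mul_UE_of_adjacent hleft
    · rw [inv_inv]
      exact UKinv_mul_UE_of_adjacent hright
    · rw [inv_inv]
      exact UK_mul_UF_of_adjacent hleft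

end
end

section
/- Assume n ≥ 3. In U(ŝl_{n+1}) the quantum Serre relation Ĕ_{r−1}^{(2)} e_r − Ĕ_{r−1} e_r Ĕ_{r−1} + e_r Ĕ_{r−1}^{(2)} = 0 holds, where Ĕ_{r−1}^{(2)} = Ĕ_{r−1}²/[2]!. -/
noncomputable section

theorem qfact_zero : qfact 0 = 1 := rfl

theorem qfact_one : qfact 1 = 1 := by
  have h := vv_sub_inv_ne_zero
  simp [qfact, qint, h]

theorem cartan_sub_one_self {m : ℕ} (hm : 3 ≤ m) (s : ZMod m) : cartan (s - 1) s = -1 := by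
  have : Fact (1 < m) := ⟨by omega⟩
  have h2 : ((2 : ℕ) : ZMod m) ≠ 0 := by
    rw [Ne, ZMod.natCast_eq_zero_iff]
    exact fun h => by have := Nat.le_of_dvd (by norm_num) h; omega
  have h : s - 1 ≠ s + 1 := fun h => h2 (by push_cast; linear_combination -h)
  simp [cartan, h]

theorem cartan_sub_one_add_one {m : ℕ} (hm : 4 ≤ m) (s : ZMod m) :
    s - 1 ≠ s + 1 ∧ cartan (s - 1) (s + 1) = 0 := by
  have : Fact (1 < m) := ⟨by omega⟩
  have h2 : ((2 : ℕ) : ZMod m) ≠ 0 := by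
    rw [Ne, ZMod.natCast_eq_zero_iff]
    exact fun h => by have := Nat.le_of_dvd (by norm_num) h; omega
  have h3 : ((3 : ℕ) : ZMod m) ≠ 0 := by
    rw [Ne, ZMod.natCast_eq_zero_iff]
    exact fun h => by have := Nat.le_of_dvd (by norm_num) h; omega
  have h : s - 1 ≠ s + 1 := fun h => h2 (by push_cast; linear_combination -h)
  have h' : s - 1 ≠ s + 1 + 1 := fun h => h3 (by push_cast; linear_combination -h)
  refine ⟨h, ?_⟩
  simp [cartan, h, h']

theorem UE_commute {m : ℕ} {i j : ZMod m} (hij : i ≠ j) (hc : cartan i j = 0) :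
    UE i * UE j = UE j * UE i := by
  have h := RingQuot.mkAlgHom_rel Qv (URel.serreE i j hij)
  simp only [hc, dp, Int.sub_zero, Int.toNat_one, Finset.sum_range_succ, Finset.sum_range_zero,
    map_add, map_smul, map_mul, map_pow, map_zero] at h
  simp [qfact_zero, qfact_one] at h
  change UE j * UE i + -(UE i * UE j) = 0 at h
  rw [← sub_eq_add_neg, sub_eq_zero] at h
  exact h.symm

theorem UE_serre {m : ℕ} {i j : ZMod m} (hij : i ≠ j) (hc : cartan i j = -1) :
    UE j * dp (UE i) 2 - UE i * UE j * UE i + dp (UE i) 2 * UE j = 0 := by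
  have h := RingQuot.mkAlgHom_rel Qv (URel.serreE i j hij)
  have ht : (1 - (-1 : ℤ)).toNat = 2 := rfl
  simp only [hc, dp, ht, Finset.sum_range_succ, Finset.sum_range_zero,
    map_add, map_smul, map_mul, map_pow, map_zero] at h
  simp [qfact_zero, qfact_one] at h
  change (qfact 2)⁻¹ • (UE j * UE i ^ 2) + -(UE i * UE j * UE i) +
    (qfact 2)⁻¹ • (UE i ^ 2 * UE j) = 0 at h
  simpa [dp, sub_eq_add_neg] using h

/-- For n ≥ 3, the quantum Serre relation between Ĕ_{r−1} and e_r. -/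
theorem serre_Erm1_er
    (n r : ℕ) (hn : 3 ≤ n) (hr : r ≤ n - 1) (ε : ℤ) (hε : ε = 1 ∨ ε = -1) :
    dp (UE ((r : ZMod (n + 1)) - 1)) 2 * er n r ε -
      UE ((r : ZMod (n + 1)) - 1) * er n r ε * UE ((r : ZMod (n + 1)) - 1) +
      er n r ε * dp (UE ((r : ZMod (n + 1)) - 1)) 2 = 0 := by
  have : Fact (1 < n + 1) := ⟨by omega⟩
  unfold er
  generalize (r : ZMod (n + 1)) = s
  obtain ⟨hne, hc⟩ := cartan_sub_one_add_one (by omega) s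
  have hxz : Commute (UE (s - 1)) (UE (s + 1)) := UE_commute hne hc
  have hS := UE_serre (i := s - 1) (j := s) (by simp) (cartan_sub_one_self (by omega) s)
  have hDz : Commute (dp (UE (s - 1)) 2) (UE (s + 1)) := (hxz.pow_left 2).smul_left _
  generalize dp (UE (s - 1)) 2 = D at *
  generalize UE (s - 1) = x at *
  generalize UE s = y at *
  generalize UE (s + 1) = z at *
  calc D * (y * z - vv ^ ε • (z * y)) - x * (y * z - vv ^ ε • (z * y)) * x +
        (y * z - vv ^ ε • (z * y)) * D
      = (D * y * z - x * y * (z * x) + y * (z * D)) -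
        vv ^ ε • (D * z * y - x * z * y * x + z * y * D) := by
        simp only [mul_sub, sub_mul, mul_smul_comm, smul_mul_assoc, smul_sub, smul_add, mul_assoc]
        abel
    _ = (y * D - x * y * x + D * y) * z - vv ^ ε • (z * (y * D - x * y * x + D * y)) := by
        rw [← hxz.eq, ← hDz.eq, hxz.eq, hDz.eq]
        simp only [mul_sub, sub_mul, mul_add, add_mul, smul_sub, smul_add, mul_assoc, hxz.eq, hDz.eq]
        abel
    _ = 0 := by simp [hS]

end
end

section
/- In U(ŝl_3) the degree-3 quantum Serre relation Ĕ_ℓ^{(3)} e − Ĕ_ℓ^{(2)} e Ĕ_ℓ + Ĕ_ℓ e Ĕ_ℓ^{(2)} − e Ĕ_ℓ^{(3)} = 0 holds, where Ĕ_ℓ^{(p)} = Ĕ_ℓ^p/[p]!. -/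
noncomputable section

theorem algebraMap_ne_zero_of_eval_ne_zero {p : Polynomial ℚ} {c : ℚ} (h : p.eval c ≠ 0) :
    algebraMap (Polynomial ℚ) Qv p ≠ 0 := by
  rw [Ne, FaithfulSMul.algebraMap_eq_zero_iff]
  rintro rfl
  simp at h

theorem vv_sq_sub_one_ne_zero : vv ^ 2 - 1 ≠ 0 := by
  have h := algebraMap_ne_zero_of_eval_ne_zero
    (p := Polynomial.X ^ 2 - 1) (c := 2) (by norm_num)
  simpa [vv] using h

theorem vv_sq_add_one_ne_zero : vv ^ 2 + 1 ≠ 0 := by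
  have h := algebraMap_ne_zero_of_eval_ne_zero
    (p := Polynomial.X ^ 2 + 1) (c := 1) (by norm_num)
  simpa [vv] using h

theorem vv_pow_four_add_sq_add_one_ne_zero : vv ^ 4 + vv ^ 2 + 1 ≠ 0 := by
  have h := algebraMap_ne_zero_of_eval_ne_zero
    (p := Polynomial.X ^ 4 + Polynomial.X ^ 2 + 1) (c := 1) (by norm_num)
  simpa [vv] using h

theorem qint_one : qint 1 = 1 := by
  simpa [qint] using div_self vv_sub_inv_ne_zero

theorem qint_two : qint 2 = vv + vv⁻¹ := by
  rw [qint, div_eq_iff vv_sub_inv_ne_zero, zpow_neg, Nat.cast_ofNat, zpow_ofNat]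
  have := vv_ne_zero
  field_simp
  ring

theorem qint_three : qint 3 = qint 2 ^ 2 - 1 := by
  rw [qint_two, qint, div_eq_iff vv_sub_inv_ne_zero, zpow_neg, Nat.cast_ofNat, zpow_ofNat]
  have := vv_ne_zero
  field_simp
  ring

theorem qint_two_ne_zero : qint 2 ≠ 0 := by
  have h : qint 2 = (vv ^ 2 + 1) / vv := by
    rw [qint_two]
    field_simp [vv_ne_zero]
  rw [h]
  exact div_ne_zero vv_sq_add_one_ne_zero vv_ne_zero

theorem qint_three_ne_zero : qint 3 ≠ 0 := by
  have h : qint 3 = (vv ^ 4 + vv ^ 2 + 1) / vv ^ 2 := by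
    rw [qint_three, qint_two]
    field_simp [vv_ne_zero]
    ring
  rw [h]
  exact div_ne_zero vv_pow_four_add_sq_add_one_ne_zero (pow_ne_zero _ vv_ne_zero)

section DividedPowers

variable {A : Type} [Ring A] [Algebra Qv A] (x : A)

theorem dp_zero : dp x 0 = 1 := by simp [dp, qfact]

theorem dp_one : dp x 1 = x := by simp [dp, qfact, qint_one]

theorem dp_two : dp x 2 = (qint 2)⁻¹ • x ^ 2 := by simp [dp, qfact, qint_one]

theorem dp_three : dp x 3 = ((qint 3)⁻¹ * (qint 2)⁻¹) • x ^ 3 := by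
  simp [dp, qfact, qint_one, mul_comm]

theorem map_dp {B : Type} [Ring B] [Algebra Qv B] (φ : A →ₐ[Qv] B) (p : ℕ) :
    φ (dp x p) = dp (φ x) p := by
  simp [dp]

end DividedPowers

/-- The quadratic quantum Serre relations for `a` and `b` imply the cubic one for `a * b`. -/
theorem cubic_serre_mul {R A : Type*} [CommRing R] [Ring A] [Algebra R A] (q : R) {x a b : A}
    (ha : x ^ 2 * a - q • (x * a * x) + a * x ^ 2 = 0)
    (hb : x ^ 2 * b - q • (x * b * x) + b * x ^ 2 = 0) :
    x ^ 3 * (a * b) - (q ^ 2 - 1) • (x ^ 2 * (a * b) * x) +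
      (q ^ 2 - 1) • (x * (a * b) * x ^ 2) - a * b * x ^ 3 = 0 := by
  have h₁ := congrArg (fun y => x * y * b) ha
  have h₂ := congrArg (fun y => y * x * b) ha
  have h₃ := congrArg (fun y => y * b * x) ha
  have h₄ := congrArg (fun y => x * a * y) hb
  have h₅ := congrArg (fun y => a * x * y) hb
  have h₆ := congrArg (fun y => a * y * x) hb
  simp only [pow_succ, pow_zero, one_mul, mul_add, add_mul, mul_sub, sub_mul, mul_smul_comm,
    smul_mul_assoc, mul_assoc, mul_zero, zero_mul] at h₁ h₂ h₃ h₄ h₅ h₆ ⊢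
  linear_combination (norm := module) h₁ + q • h₂ - (q ^ 2 - 1) • h₃ + (q ^ 2 - 1) • h₄ - q • h₅ - h₆

/-- The quadratic quantum Serre relations for `a` and `b` imply the cubic one for
`a * b - c • (b * a)`. -/
theorem cubic_serre_mul_sub_smul_mul {R A : Type*} [CommRing R] [Ring A] [Algebra R A]
    (q c : R) {x a b : A}
    (ha : x ^ 2 * a - q • (x * a * x) + a * x ^ 2 = 0)
    (hb : x ^ 2 * b - q • (x * b * x) + b * x ^ 2 = 0) :
    x ^ 3 * (a * b - c • (b * a)) - (q ^ 2 - 1) • (x ^ 2 * (a * b - c • (b * a)) * x) +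
      (q ^ 2 - 1) • (x * (a * b - c • (b * a)) * x ^ 2) - (a * b - c • (b * a)) * x ^ 3 = 0 := by
  have hab := cubic_serre_mul q ha hb
  have hba := cubic_serre_mul q hb ha
  simp only [mul_sub, sub_mul, mul_smul_comm, smul_mul_assoc]
  linear_combination (norm := module) hab - c • hba

/-- The quadratic quantum Serre relation with divided powers cleared. -/
theorem quadratic_serre_of_dp {A : Type} [Ring A] [Algebra Qv A] {x y : A}
    (h : ∑ p ∈ Finset.range 3, ((-1 : Qv) ^ p) • (dp x p * y * dp x (2 - p)) = 0) :
    x ^ 2 * y - qint 2 • (x * y * x) + y * x ^ 2 = 0 := by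
  have hq := congrArg (qint 2 • ·) h
  simp only [Finset.sum_range_succ, Finset.sum_range_zero, zero_add, pow_zero, pow_one, one_smul,
    neg_smul, neg_one_sq, dp_zero, dp_one, dp_two, one_mul, mul_one, smul_mul_assoc,
    mul_smul_comm, smul_add, smul_neg, smul_smul, mul_inv_cancel₀ qint_two_ne_zero,
    Nat.sub_zero, Nat.sub_self, Nat.add_one_sub_one, smul_zero] at hq
  rw [← hq]
  abel

theorem cartan_eq_neg_one {k l : ZMod 3} (h : k ≠ l) : cartan k l = -1 := by
  revert k l
  decide

theorem quadratic_serre_UE {k l : ZMod 3} (h : k ≠ l) :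
    (UE k : U 3) ^ 2 * UE l - qint 2 • (UE k * UE l * UE k) + UE l * UE k ^ 2 = 0 := by
  have hs := RingQuot.mkAlgHom_rel Qv (URel.serreE k l h)
  have hn : (1 - cartan k l).toNat = 2 := by rw [cartan_eq_neg_one h]; rfl
  simp only [hn, map_sum, map_smul, map_mul, map_dp, map_zero] at hs
  exact quadratic_serre_of_dp hs

/-- The divided-power form of the cubic quantum Serre relation. -/
theorem cubic_serre_dp {A : Type} [Ring A] [Algebra Qv A] {x y : A}
    (h : x ^ 3 * y - (qint 2 ^ 2 - 1) • (x ^ 2 * y * x) +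
      (qint 2 ^ 2 - 1) • (x * y * x ^ 2) - y * x ^ 3 = 0) :
    dp x 3 * y - dp x 2 * y * x + x * y * dp x 2 - y * dp x 3 = 0 := by
  rw [← qint_three] at h
  have hs := congrArg (((qint 3)⁻¹ * (qint 2)⁻¹) • ·) h
  have hc : (qint 3)⁻¹ * (qint 2)⁻¹ * qint 3 = (qint 2)⁻¹ := by
    field_simp [qint_three_ne_zero]
  simpa only [dp_two, dp_three, smul_sub, smul_add, smul_smul, hc, smul_mul_assoc,
    mul_smul_comm, smul_zero] using hs

/-- In U(ŝl_3), the degree-3 quantum Serre relation between Ĕ_ℓ and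
e = Ĕ_i Ĕ_j − v^ε Ĕ_j Ĕ_i, where j = i+1, ℓ = i+2. -/
theorem serre_deg3_El_e
    (i : ZMod 3) (ε : ℤ) (hε : ε = 1 ∨ ε = -1) :
    dp (UE (i + 2)) 3 * (UE i * UE (i + 1) - vv ^ ε • (UE (i + 1) * UE i)) -
      dp (UE (i + 2)) 2 * (UE i * UE (i + 1) - vv ^ ε • (UE (i + 1) * UE i)) * UE (i + 2) +
      UE (i + 2) * (UE i * UE (i + 1) - vv ^ ε • (UE (i + 1) * UE i)) * dp (UE (i + 2)) 2 -
      (UE i * UE (i + 1) - vv ^ ε • (UE (i + 1) * UE i)) * dp (UE (i + 2)) 3 = 0 := by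
  have ha := quadratic_serre_UE (k := i + 2) (l := i) (by clear * -; revert i; decide)
  have hb := quadratic_serre_UE (k := i + 2) (l := i + 1) (by clear * -; revert i; decide)
  exact cubic_serre_dp (cubic_serre_mul_sub_smul_mul (qint 2) (vv ^ ε) ha hb)

end
end

section
/- In U(ŝl_3) the degree-3 quantum Serre relation e^{(3)} Ĕ_ℓ − e^{(2)} Ĕ_ℓ e + e Ĕ_ℓ e^{(2)} − Ĕ_ℓ e^{(3)} = 0 holds, where e^{(p)} = e^p/[p]!. -/
noncomputable section

section QuantumSerre

variable {K A : Type*} [Field K] [Ring A] [Algebra K A]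

/-- If `x` and `y` satisfy the quantum Serre relation `x²y - [2]xyx + yx² = 0`, then `x` commutes
with the `q`-commutator `xy - q yx` up to the factor `q⁻¹`. -/
theorem mul_qcommutator_of_serre {q : K} (hq : q ≠ 0) {x y : A}
    (h : x * x * y - (q + q⁻¹) • (x * y * x) + y * x * x = 0) :
    x * (x * y - q • (y * x)) = q⁻¹ • ((x * y - q • (y * x)) * x) := by
  linear_combination (norm := skip) h
  simp only [mul_sub, sub_mul, mul_assoc, mul_smul_comm, smul_mul_assoc]
  match_scalars <;> field_simp <;> ring

/-- If `x` and `y` satisfy the quantum Serre relation `y²x - [2]yxy + xy² = 0`, then `y` commutes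
with the `q`-commutator `xy - q yx` up to the factor `q`. -/
theorem mul_qcommutator_of_serre' {q : K} (hq : q ≠ 0) {x y : A}
    (h : y * y * x - (q + q⁻¹) • (y * x * y) + x * y * y = 0) :
    y * (x * y - q • (y * x)) = q • ((x * y - q • (y * x)) * y) := by
  linear_combination (norm := skip) (-q) • h
  simp only [mul_sub, sub_mul, mul_assoc, mul_smul_comm, smul_mul_assoc]
  match_scalars <;> field_simp <;> ring

/-- The degree-3 quantum Serre relation for an element `e` and `c`, where `e` is the
`q`-commutator of `a` and `b`, and `c` satisfies the degree-2 relations with `a` and `b`. -/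
theorem serre_deg3_of_qcommutator {q : K} (hq : q ≠ 0) (h2 : q ^ 2 + 1 ≠ 0)
    (h3 : q ^ 4 + q ^ 2 + 1 ≠ 0) {a b c e : A}
    (hab : a * b = e + q • (b * a)) (hae : a * e = q⁻¹ • (e * a)) (hbe : b * e = q • (e * b))
    (hac : a * a * c - (q + q⁻¹) • (a * c * a) + c * a * a = 0)
    (hbc : b * b * c - (q + q⁻¹) • (b * c * b) + c * b * b = 0) :
    e ^ 3 * c - (q ^ 2 + 1 + q⁻¹ ^ 2) • (e ^ 2 * c * e) +
      (q ^ 2 + 1 + q⁻¹ ^ 2) • (e * c * e ^ 2) - c * e ^ 3 = 0 := by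
  have hab' (z : A) : a * (b * z) = e * z + q • (b * (a * z)) := by
    rw [← mul_assoc, hab, add_mul, smul_mul_assoc, mul_assoc]
  have hae' (z : A) : a * (e * z) = q⁻¹ • (e * (a * z)) := by
    rw [← mul_assoc, hae, smul_mul_assoc, mul_assoc]
  have hbe' (z : A) : b * (e * z) = q • (e * (b * z)) := by
    rw [← mul_assoc, hbe, smul_mul_assoc, mul_assoc]
  have h3' : q ^ 2 * (q ^ 2 + 1) + 1 ≠ 0 := by convert h3 using 1; ring
  linear_combination (norm := skip)
    (q ^ 2 / (q ^ 4 + q ^ 2 + 1)) • (hac * b ^ 3 * a) -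
    (q ^ 3 / (q ^ 2 + 1)) • (hac * e * b ^ 2) -
    q • (b * hac * b ^ 2 * a) +
    (q ^ 3) • (b * hac * e * b) +
    (q ^ 2) • (b ^ 2 * hac * b * a) -
    (q ^ 5 / (q ^ 2 + 1)) • (b ^ 2 * hac * e) -
    (q ^ 5 / (q ^ 4 + q ^ 2 + 1)) • (b ^ 3 * hac * a) -
    (q ^ 2 / (q ^ 4 + q ^ 2 + 1)) • (a * hac * b ^ 3) +
    (q ^ 2) • (b * a * hac * b ^ 2) +
    ((q ^ 4 + q ^ 2 + 1) / (q * (q ^ 2 + 1))) • (e * hac * b ^ 2) -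
    (q ^ 4) • (b ^ 2 * a * hac * b) -
    (q ^ 4 + q ^ 2 + 1) • (e * b * hac * b) +
    (q ^ 8 / (q ^ 4 + q ^ 2 + 1)) • (b ^ 3 * a * hac) +
    (q ^ 3 * (q ^ 4 + q ^ 2 + 1) / (q ^ 2 + 1)) • (e * b ^ 2 * hac) -
    (q ^ 8 / (q ^ 4 + q ^ 2 + 1)) • (hbc * b * a ^ 3) -
    (q * (q ^ 4 + q ^ 2 + 1) / (q ^ 2 + 1)) • (hbc * e * a ^ 2) +
    (q ^ 5 / (q ^ 4 + q ^ 2 + 1)) • (b * hbc * a ^ 3) +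
    (q ^ 4) • (a * hbc * b * a ^ 2) +
    ((q ^ 4 + q ^ 2 + 1) / q) • (a * hbc * e * a) -
    (q ^ 2) • (b * a * hbc * a ^ 2) +
    (q ^ 5 / (q ^ 2 + 1)) • (e * hbc * a ^ 2) -
    (q ^ 2) • (a ^ 2 * hbc * b * a) -
    ((q ^ 4 + q ^ 2 + 1) / (q * (q ^ 2 + 1))) • (a ^ 2 * hbc * e) +
    q • (b * a ^ 2 * hbc * a) -
    (q ^ 2) • (e * a * hbc * a) +
    (q ^ 2 / (q ^ 4 + q ^ 2 + 1)) • (a ^ 3 * hbc * b) -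
    (q ^ 2 / (q ^ 4 + q ^ 2 + 1)) • (b * a ^ 3 * hbc) +
    (q / (q ^ 2 + 1)) • (e * a ^ 2 * hbc)
  simp only [pow_succ, pow_zero, one_mul, mul_add, mul_sub, add_mul, sub_mul, mul_assoc,
    mul_smul_comm, smul_mul_assoc, smul_add, smul_sub, smul_smul, mul_zero, zero_mul,
    hab, hae, hbe, hab', hae', hbe']
  match_scalars <;> field_simp <;> ring

theorem serre_deg2_of_sum {d : ℕ → K} (h0 : d 0 = 1) (h1 : d 1 = 1) (h2 : d 2 ≠ 0) {x y : A}
    (h : ∑ p ∈ Finset.range 3, (-1 : K) ^ p •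
      (((d p)⁻¹ • x ^ p) * y * ((d (2 - p))⁻¹ • x ^ (2 - p))) = 0) :
    x * x * y - d 2 • (x * y * x) + y * x * x = 0 := by
  simp only [Finset.sum_range_succ, Finset.sum_range_zero, h0, h1, Nat.sub_self, Nat.sub_zero,
    Nat.reduceSub] at h
  linear_combination (norm := skip) d 2 • h
  simp only [pow_succ, pow_zero, one_mul, mul_one, mul_assoc, mul_smul_comm, smul_mul_assoc]
  match_scalars <;> field_simp <;> ring

theorem serre_deg3_divided {s t : K} (hs : s ≠ 0) (ht : t ≠ 0) {x y : A}
    (h : x ^ 3 * y - t • (x ^ 2 * y * x) + t • (x * y * x ^ 2) - y * x ^ 3 = 0) :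
    ((t * s)⁻¹ • x ^ 3) * y - (s⁻¹ • x ^ 2) * y * x + x * y * (s⁻¹ • x ^ 2) -
      y * ((t * s)⁻¹ • x ^ 3) = 0 := by
  linear_combination (norm := skip) (t * s)⁻¹ • h
  simp only [mul_smul_comm, smul_mul_assoc]
  match_scalars <;> field_simp <;> ring

end QuantumSerre

theorem algebraMap_ratFunc_ne_zero {p : Polynomial ℚ} (r : ℚ) (h : p.eval r ≠ 0) :
    algebraMap (Polynomial ℚ) (RatFunc ℚ) p ≠ 0 := by
  rw [Ne, FaithfulSMul.algebraMap_eq_zero_iff]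
  rintro rfl
  simp at h

theorem qfact_two : qfact 2 = vv + vv⁻¹ := by
  have h : qfact 2 = qint 2 := by rw [qfact, qfact_one, mul_one]
  rw [h, qint, div_eq_iff vv_sub_inv_ne_zero, zpow_neg]
  have := vv_ne_zero
  norm_cast
  field_simp
  ring

theorem qfact_three : qfact 3 = (vv ^ 2 + 1 + vv⁻¹ ^ 2) * qfact 2 := by
  rw [qfact, qint]
  congr 1
  rw [div_eq_iff vv_sub_inv_ne_zero, zpow_neg]
  have := vv_ne_zero
  norm_cast
  field_simp
  ring

theorem qfact_two_ne_zero : qfact 2 ≠ 0 := by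
  have h : qfact 2 = (vv ^ 2 + 1) / vv := by
    rw [qfact_two]
    have := vv_ne_zero
    field_simp
  rw [h]
  exact div_ne_zero vv_sq_add_one_ne_zero vv_ne_zero

theorem qint_three_ne_zero_s9 : vv ^ 2 + 1 + vv⁻¹ ^ 2 ≠ 0 := by
  have h : vv ^ 2 + 1 + vv⁻¹ ^ 2 = (vv ^ 4 + vv ^ 2 + 1) / vv ^ 2 := by
    have := vv_ne_zero
    field_simp
  rw [h]
  exact div_ne_zero vv_pow_four_add_sq_add_one_ne_zero (pow_ne_zero 2 vv_ne_zero)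

theorem cartan_three_of_ne {i j : ZMod 3} (h : i ≠ j) : cartan i j = -1 := by
  revert i j
  decide

theorem UE_serre_s9 {i j : ZMod 3} (h : i ≠ j) :
    UE i * UE i * UE j - (vv + vv⁻¹) • (UE i * UE j * UE i) + UE j * UE i * UE i = 0 := by
  have hrel := RingQuot.mkAlgHom_rel Qv (URel.serreE i j h)
  simp only [cartan_three_of_ne h, dp, map_sum, map_smul, map_mul, map_pow, map_zero] at hrel
  rw [← qfact_two]
  exact serre_deg2_of_sum rfl qfact_one qfact_two_ne_zero hrel

/-- In U(ŝl_3), the degree-3 quantum Serre relation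
e^{(3)} Ĕ_ℓ − e^{(2)} Ĕ_ℓ e + e Ĕ_ℓ e^{(2)} − Ĕ_ℓ e^{(3)} = 0, where
e = Ĕ_i Ĕ_j − v^ε Ĕ_j Ĕ_i, j = i+1, ℓ = i+2. -/
theorem serre_deg3_e_El
    (i : ZMod 3) (ε : ℤ) (hε : ε = 1 ∨ ε = -1) :
    dp (UE i * UE (i + 1) - vv ^ ε • (UE (i + 1) * UE i)) 3 * UE (i + 2) -
      dp (UE i * UE (i + 1) - vv ^ ε • (UE (i + 1) * UE i)) 2 * UE (i + 2) *
        (UE i * UE (i + 1) - vv ^ ε • (UE (i + 1) * UE i)) +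
      (UE i * UE (i + 1) - vv ^ ε • (UE (i + 1) * UE i)) * UE (i + 2) *
        dp (UE i * UE (i + 1) - vv ^ ε • (UE (i + 1) * UE i)) 2 -
      UE (i + 2) * dp (UE i * UE (i + 1) - vv ^ ε • (UE (i + 1) * UE i)) 3 = 0 := by
  have hv := vv_ne_zero
  have hij : i ≠ i + 1 := by revert i; decide
  have hil : i ≠ i + 2 := by revert i; decide
  have hjl : i + 1 ≠ i + 2 := by revert i; decide
  obtain ⟨hq, hsum, h2, h3, hsq⟩ : vv ^ ε ≠ 0 ∧ vv ^ ε + (vv ^ ε)⁻¹ = vv + vv⁻¹ ∧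
      (vv ^ ε) ^ 2 + 1 ≠ 0 ∧ (vv ^ ε) ^ 4 + (vv ^ ε) ^ 2 + 1 ≠ 0 ∧
      (vv ^ ε) ^ 2 + 1 + (vv ^ ε)⁻¹ ^ 2 = vv ^ 2 + 1 + vv⁻¹ ^ 2 := by
    rcases hε with rfl | rfl
    · rw [zpow_one]
      exact ⟨hv, rfl, vv_sq_add_one_ne_zero, vv_pow_four_add_sq_add_one_ne_zero, rfl⟩
    · rw [zpow_neg_one, inv_inv]
      refine ⟨inv_ne_zero hv, add_comm _ _, fun h ↦ vv_sq_add_one_ne_zero ?_,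
        fun h ↦ vv_pow_four_add_sq_add_one_ne_zero ?_, by ring⟩ <;>
      · field_simp at h
        linear_combination h
  generalize vv ^ ε = q at *
  have hserre {k l : ZMod 3} (h : k ≠ l) :
      UE k * UE k * UE l - (q + q⁻¹) • (UE k * UE l * UE k) + UE l * UE k * UE k = 0 :=
    hsum ▸ UE_serre_s9 h
  have main := serre_deg3_of_qcommutator hq h2 h3 (sub_add_cancel _ _).symm
    (mul_qcommutator_of_serre hq (hserre hij)) (mul_qcommutator_of_serre' hq (hserre hij.symm))
    (hserre hil) (hserre hjl)
  rw [hsq] at main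
  simp only [dp, qfact_three]
  exact serre_deg3_divided qfact_two_ne_zero qint_three_ne_zero_s9 main

end
end

section
/- For all integers p ≥ 1, r_i(r_j(e^{(p)})) = (v − v⁻¹) v^{p−2} e^{(p−1)}. -/
noncomputable section

/-- The positive half U⁺: the subalgebra of U(ŝl_3) generated by the Ĕ_k. -/
def Uplus : Subalgebra Qv (U 3) := Algebra.adjoin Qv (Set.range (UE (m := 3)))

/-- The generator Ĕ_k, viewed as an element of U⁺. -/
def Egen (k : ZMod 3) : Uplus := ⟨UE k, Algebra.subset_adjoin ⟨k, rfl⟩⟩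

/-- The submodule of U⁺ of homogeneous elements of multidegree d ∈ ℕ^{ℤ/3ℤ}. -/
def homog (d : ZMod 3 → ℕ) : Submodule Qv Uplus :=
  Submodule.span Qv
    {x | ∃ w : List (ZMod 3), (∀ c, w.count c = d c) ∧ x = (w.map Egen).prod}

/-- k·|y| = 2y_k − y_{k+1} − y_{k−1} for a multidegree |y| = d. -/
def kdot (k : ZMod 3) (d : ZMod 3 → ℕ) : ℤ :=
  2 * (d k : ℤ) - (d (k + 1) : ℤ) - (d (k - 1) : ℤ)

/-- The family rr of ℚ(v)-linear maps r_k : U⁺ → U⁺ is the family of Lusztig's twisted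
derivations: r_k(1) = 0, r_k(Ĕ_{k'}) = δ_{k,k'}, and
r_k(xy) = v^{k·|y|} r_k(x) y + x r_k(y) for homogeneous x, y. -/
def IsTwistedDerivation (rr : ZMod 3 → (Uplus →ₗ[Qv] Uplus)) : Prop :=
  (∀ k, rr k 1 = 0) ∧
  (∀ k k', rr k (Egen k') = if k = k' then 1 else 0) ∧
  (∀ k (dx dy : ZMod 3 → ℕ) (x y : Uplus), x ∈ homog dx → y ∈ homog dy →
    rr k (x * y) = vv ^ kdot k dy • (rr k x * y) + x * rr k y)

/-- The element e = Ĕ_i Ĕ_j − v⁻¹ Ĕ_j Ĕ_i ∈ U⁺, with j = i + 1. -/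
def ee (i : ZMod 3) : Uplus :=
  Egen i * Egen (i + 1) - vv⁻¹ • (Egen (i + 1) * Egen i)

theorem mul_mem_homog {a b : ZMod 3 → ℕ} {x y : Uplus} (hx : x ∈ homog a) (hy : y ∈ homog b) :
    x * y ∈ homog (a + b) := by
  have hxy := Submodule.mul_mem_mul hx hy
  rw [homog, homog, Submodule.span_mul_span] at hxy
  refine Submodule.span_mono ?_ hxy
  rintro _ ⟨_, ⟨w₁, h₁, rfl⟩, _, ⟨w₂, h₂, rfl⟩, rfl⟩
  exact ⟨w₁ ++ w₂, fun c => by simp [h₁, h₂], by simp⟩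

theorem one_mem_homog : (1 : Uplus) ∈ homog 0 :=
  Submodule.subset_span ⟨[], fun c => by simp, by simp⟩

theorem Egen_mem_homog (k : ZMod 3) : Egen k ∈ homog (Pi.single k 1) := by
  refine Submodule.subset_span ⟨[k], fun c => ?_, by simp⟩
  by_cases h : c = k
  · simp [h]
  · simp [h, Ne.symm h]

/-- The multidegree of `ee i`. -/
def eeDeg (i : ZMod 3) : ZMod 3 → ℕ := Pi.single i 1 + Pi.single (i + 1) 1

theorem ee_eq_add (i : ZMod 3) :
    ee i = Egen i * Egen (i + 1) + (-vv⁻¹) • (Egen (i + 1) * Egen i) := by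
  exact (sub_eq_add_neg _ _).trans
    (congrArg _ (neg_smul vv⁻¹ (Egen (i + 1) * Egen i)).symm)

theorem ee_mem_homog (i : ZMod 3) : ee i ∈ homog (eeDeg i) := by
  rw [ee_eq_add]
  refine Submodule.add_mem _ (mul_mem_homog (Egen_mem_homog _) (Egen_mem_homog _))
    (Submodule.smul_mem _ _ ?_)
  rw [eeDeg, add_comm]
  exact mul_mem_homog (Egen_mem_homog _) (Egen_mem_homog _)

theorem ee_pow_mem_homog (i : ZMod 3) (p : ℕ) : ee i ^ p ∈ homog (p • eeDeg i) := by
  induction p with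
  | zero => simpa using one_mem_homog
  | succ p ih =>
    rw [pow_succ, succ_nsmul]
    exact mul_mem_homog ih (ee_mem_homog i)

theorem kdot_eeDeg (i : ZMod 3) : kdot i (eeDeg i) = 1 := by
  revert i; decide

theorem kdot_succ_eeDeg (i : ZMod 3) : kdot (i + 1) (eeDeg i) = 1 := by
  revert i; decide

theorem kdot_single_succ (i : ZMod 3) : kdot i (Pi.single (i + 1) 1) = -1 := by
  revert i; decide

theorem kdot_succ_single (i : ZMod 3) : kdot (i + 1) (Pi.single i 1) = -1 := by
  revert i; decide

theorem vv_pow_ne_one {n : ℕ} (hn : n ≠ 0) : vv ^ n ≠ 1 := by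
  rw [vv, ← RatFunc.algebraMap_X, ← map_pow, ← map_one (algebraMap (Polynomial ℚ) (RatFunc ℚ))]
  intro h
  have h' := congrArg Polynomial.natDegree (RatFunc.algebraMap_injective ℚ h)
  simp [hn] at h'

theorem vv_zpow_sub_ne_zero {n : ℕ} (hn : n ≠ 0) : vv ^ (n : ℤ) - vv ^ (-(n : ℤ)) ≠ 0 := by
  intro h
  refine vv_pow_ne_one (n := n + n) (by omega) ?_
  rw [sub_eq_zero, zpow_neg, zpow_natCast] at h
  rw [pow_add]
  nth_rewrite 2 [h]
  exact mul_inv_cancel₀ (pow_ne_zero _ vv_ne_zero)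

theorem qint_ne_zero {n : ℕ} (hn : n ≠ 0) : qint n ≠ 0 :=
  div_ne_zero (vv_zpow_sub_ne_zero hn) vv_sub_inv_ne_zero

theorem sub_inv_mul_qint (n : ℕ) : (vv - vv⁻¹) * qint n = vv ^ n - (vv ^ n)⁻¹ := by
  rw [qint, mul_div_cancel₀ _ vv_sub_inv_ne_zero, zpow_neg, zpow_natCast]

namespace IsTwistedDerivation

variable {rr : ZMod 3 → (Uplus →ₗ[Qv] Uplus)}

theorem apply_ee (hrr : IsTwistedDerivation rr) (i : ZMod 3) : rr i (ee i) = 0 := by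
  obtain ⟨-, hE, hmul⟩ := hrr
  rw [ee_eq_add, map_add, map_smul, hmul i _ _ _ _ (Egen_mem_homog i) (Egen_mem_homog (i + 1)),
    hmul i _ _ _ _ (Egen_mem_homog (i + 1)) (Egen_mem_homog i), kdot_single_succ]
  simp [hE, ← add_smul]

theorem apply_succ_ee (hrr : IsTwistedDerivation rr) (i : ZMod 3) :
    rr (i + 1) (ee i) = (1 - vv⁻¹ * vv⁻¹) • Egen i := by
  obtain ⟨-, hE, hmul⟩ := hrr
  rw [ee_eq_add, map_add, map_smul, hmul _ _ _ _ _ (Egen_mem_homog i) (Egen_mem_homog (i + 1)),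
    hmul _ _ _ _ _ (Egen_mem_homog (i + 1)) (Egen_mem_homog i), kdot_succ_single]
  simp [hE, sub_eq_add_neg, add_smul, ← neg_mul, mul_smul]

theorem apply_ee_pow (hrr : IsTwistedDerivation rr) (i : ZMod 3) (p : ℕ) :
    rr i (ee i ^ p) = 0 := by
  induction p with
  | zero => simpa using hrr.1 i
  | succ p ih =>
    rw [pow_succ, hrr.2.2 i _ _ _ _ (ee_pow_mem_homog i p) (ee_mem_homog i), ih, hrr.apply_ee]
    simp

theorem apply_succ_ee_pow_succ (hrr : IsTwistedDerivation rr) (i : ZMod 3) (p : ℕ) :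
    rr (i + 1) (ee i ^ (p + 1)) =
      vv • (rr (i + 1) (ee i ^ p) * ee i) + (1 - vv⁻¹ * vv⁻¹) • (ee i ^ p * Egen i) := by
  rw [pow_succ, hrr.2.2 _ _ _ _ _ (ee_pow_mem_homog i p) (ee_mem_homog i), hrr.apply_succ_ee,
    kdot_succ_eeDeg, zpow_one, mul_smul_comm]

theorem apply_succ_ee_pow_mem_homog (hrr : IsTwistedDerivation rr) (i : ZMod 3) (p : ℕ) :
    rr (i + 1) (ee i ^ (p + 1)) ∈ homog (p • eeDeg i + Pi.single i 1) := by
  induction p with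
  | zero =>
    rw [hrr.apply_succ_ee_pow_succ]
    simpa [hrr.1] using Submodule.smul_mem _ _ (Egen_mem_homog i)
  | succ p ih =>
    rw [hrr.apply_succ_ee_pow_succ]
    refine Submodule.add_mem _ (Submodule.smul_mem _ _ ?_) (Submodule.smul_mem _ _
      (mul_mem_homog (ee_pow_mem_homog i _) (Egen_mem_homog i)))
    rw [succ_nsmul, add_right_comm]
    exact mul_mem_homog ih (ee_mem_homog i)

theorem apply_ee_pow_mul_Egen (hrr : IsTwistedDerivation rr) (i : ZMod 3) (p : ℕ) :
    rr i (ee i ^ p * Egen i) = ee i ^ p := by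
  rw [hrr.2.2 _ _ _ _ _ (ee_pow_mem_homog i p) (Egen_mem_homog i), hrr.apply_ee_pow, hrr.2.1]
  simp

theorem apply_apply_succ_ee_pow (hrr : IsTwistedDerivation rr) (i : ZMod 3) (p : ℕ) :
    rr i (rr (i + 1) (ee i ^ (p + 1))) =
      ((vv - vv⁻¹) * vv ^ ((p : ℤ) - 1) * qint (p + 1)) • ee i ^ p := by
  have hv := vv_ne_zero
  induction p with
  | zero =>
    rw [hrr.apply_succ_ee_pow_succ, pow_zero, hrr.1]
    simp only [zero_mul, smul_zero, zero_add, one_mul, map_smul, hrr.2.1, if_true]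
    congr 1
    rw [mul_right_comm, sub_inv_mul_qint]
    simp
    field_simp
  | succ p ih =>
    rw [hrr.apply_succ_ee_pow_succ, map_add, map_smul, map_smul, hrr.apply_ee_pow_mul_Egen,
      hrr.2.2 _ _ _ _ _ (hrr.apply_succ_ee_pow_mem_homog i p) (ee_mem_homog i), ih,
      hrr.apply_ee, kdot_eeDeg, mul_zero, add_zero, zpow_one, smul_mul_assoc, ← pow_succ,
      smul_smul, smul_smul, ← add_smul]
    congr 1
    rw [mul_right_comm (vv - vv⁻¹), sub_inv_mul_qint, mul_right_comm (vv - vv⁻¹),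
      sub_inv_mul_qint, zpow_sub₀ hv, zpow_sub₀ hv, zpow_natCast, zpow_natCast, zpow_one]
    field_simp
    ring

end IsTwistedDerivation

/-- for p ≥ 1, r_i(r_j(e^{(p)})) = (v − v⁻¹) v^{p−2} e^{(p−1)}. -/
theorem twisted_derivation_ri_rj
    (rr : ZMod 3 → (Uplus →ₗ[Qv] Uplus)) (hrr : IsTwistedDerivation rr)
    (i : ZMod 3) (p : ℕ) (hp : 1 ≤ p) :
    rr i (rr (i + 1) (dp (ee i) p)) =
      ((vv - vv⁻¹) * vv ^ ((p : ℤ) - 2)) • dp (ee i) (p - 1) := by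
  obtain ⟨p, rfl⟩ := Nat.exists_eq_add_of_le' hp
  rw [dp, dp, map_smul, map_smul, hrr.apply_apply_succ_ee_pow, Nat.add_sub_cancel, smul_smul,
    smul_smul, qfact, mul_inv]
  congr 1
  have hq := qint_ne_zero p.succ_ne_zero
  rw [show ((p + 1 : ℕ) : ℤ) - 2 = p - 1 by push_cast; ring]
  field_simp

end
end
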